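/- arXiv:2406.19909 — 4 statements merged into one kernel-verified Lean document; each statement's English description precedes it below -/
import Mathlib

section
/- Let (Ξ, Ξ^∞) and (Λ, Λ^∞) be countable approximate groups, and let f : (Ξ, Ξ^∞) → (Λ, Λ^∞) be a symmetric unital quasimorphism. Then asdim Ξ ≤ asdim Λ + asdim (f⁻¹(D(f))), where D(f) is the defect set of f, and where the asymptotic dimensions of Ξ and of f⁻¹(D(f)) are computed with respect to the restriction of any left-invariant proper metric on Ξ^∞, and the asymptotic dimension of Λ with respect to the restriction of any left-invariant proper metric on Λ^∞. -/
open Set Filter Pointwise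

section Defs

variable {X Y G H : Type*}

/-- `d` is a metric on `X`. -/
def IsMetric (d : X → X → ℝ) : Prop :=
  (∀ x y, 0 ≤ d x y) ∧ (∀ x y, d x y = 0 ↔ x = y) ∧ (∀ x y, d x y = d y x) ∧
    (∀ x y z, d x z ≤ d x y + d y z)

/-- `d` is a left-invariant metric on the group `G`. -/
def IsLeftInvariant [Group G] (d : G → G → ℝ) : Prop :=
  ∀ g x y : G, d (g * x) (g * y) = d x y

/-- `d` is proper: closed balls are compact, where a countable group is regarded as a
discrete topological space. -/
def IsProperMetric (d : G → G → ℝ) : Prop :=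
  ∀ (x : G) (r : ℝ), @IsCompact G ⊥ {y | d x y ≤ r}

/-- The (left) defect set `D(f) = {f(y)⁻¹ f(x)⁻¹ f(xy) | x y ∈ G}` of a map between groups. -/
def defectSet [Group G] [Group H] (f : G → H) : Set H :=
  {h | ∃ x y : G, h = (f y)⁻¹ * (f x)⁻¹ * f (x * y)}

/-- `f` is a quasimorphism if its defect set is finite. -/
def IsQuasimorphism [Group G] [Group H] (f : G → H) : Prop :=
  (defectSet f).Finite

/-- `f` is symmetric: `f(a⁻¹) = f(a)⁻¹`. -/
def IsSymmetricMap [Group G] [Group H] (f : G → H) : Prop :=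
  ∀ a : G, f a⁻¹ = (f a)⁻¹

/-- `f` is unital: `f(e) = e`. -/
def IsUnitalMap [Group G] [Group H] (f : G → H) : Prop :=
  f 1 = 1

/-- `Λ` is an approximate subgroup of `G`: symmetric, unital and `Λ² ⊆ ΛF` for a finite `F`. -/
def IsApproxSubgroup [Group G] (Λ : Set G) : Prop :=
  Λ⁻¹ = Λ ∧ (1 : G) ∈ Λ ∧ ∃ F : Set G, F.Finite ∧ Λ * Λ ⊆ Λ * F

/-- The subset `s` of `X` has asymptotic dimension at most `n`, with respect to the
(restriction of the) metric `d`: for every `R > 0` there is a cover of `s` by subsets of `s`,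
uniformly bounded by some `D > 0`, splitting into `n + 1` `R`-disjoint families. -/
def ASDimLE (d : X → X → ℝ) (s : Set X) (n : ℕ) : Prop :=
  ∀ R : ℝ, 0 < R → ∃ D : ℝ, 0 < D ∧ ∃ 𝒰 : Fin (n + 1) → Set (Set X),
    (∀ i, ∀ u ∈ 𝒰 i, u ⊆ s) ∧
    (s ⊆ ⋃ i, ⋃₀ 𝒰 i) ∧
    (∀ i, ∀ u ∈ 𝒰 i, ∀ x ∈ u, ∀ y ∈ u, d x y ≤ D) ∧
    (∀ i, ∀ u ∈ 𝒰 i, ∀ v ∈ 𝒰 i, u ≠ v → ∀ x ∈ u, ∀ y ∈ v, R ≤ d x y)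

/-- The asymptotic dimension of the subset `s` of `X` with respect to the metric `d`,
as an element of `ℕ∞` (`⊤` means infinite asymptotic dimension). -/
noncomputable def asdim (d : X → X → ℝ) (s : Set X) : ℕ∞ :=
  sInf ((fun n : ℕ => (n : ℕ∞)) '' {n | ASDimLE d s n})

/-- A family `𝒴` of subsets of `X` has asymptotic dimension uniformly bounded by `n`: for
every `R > 0` there is a common `D > 0` such that every member admits a `D`-bounded cover
splitting into `n + 1` `R`-disjoint families. -/
def ASDimUnifLE {ι : Type*} (d : X → X → ℝ) (𝒴 : ι → Set X) (n : ℕ) : Prop :=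
  ∀ R : ℝ, 0 < R → ∃ D : ℝ, 0 < D ∧ ∀ α : ι, ∃ 𝒰 : Fin (n + 1) → Set (Set X),
    (∀ i, ∀ u ∈ 𝒰 i, u ⊆ 𝒴 α) ∧
    (𝒴 α ⊆ ⋃ i, ⋃₀ 𝒰 i) ∧
    (∀ i, ∀ u ∈ 𝒰 i, ∀ x ∈ u, ∀ y ∈ u, d x y ≤ D) ∧
    (∀ i, ∀ u ∈ 𝒰 i, ∀ v ∈ 𝒰 i, u ≠ v → ∀ x ∈ u, ∀ y ∈ v, R ≤ d x y)

/-- `f` is coarsely Lipschitz on the subset `s`. -/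
def IsCoarselyLipschitzOn (dX : X → X → ℝ) (dY : Y → Y → ℝ) (s : Set X) (f : X → Y) : Prop :=
  ∃ Φ : ℝ → ℝ, (∀ t, 0 ≤ t → 0 ≤ Φ t) ∧ MonotoneOn Φ (Ici (0 : ℝ)) ∧
    Tendsto Φ atTop atTop ∧ ∀ x ∈ s, ∀ x' ∈ s, dY (f x) (f x') ≤ Φ (dX x x')

/-- `f` is coarsely Lipschitz: `d_Y(f x, f x') ≤ Φ₊(d_X(x, x'))` for a non-decreasing
`Φ₊ : [0,∞) → [0,∞)` tending to `∞`. -/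
def IsCoarselyLipschitz (dX : X → X → ℝ) (dY : Y → Y → ℝ) (f : X → Y) : Prop :=
  ∃ Φ : ℝ → ℝ, (∀ t, 0 ≤ t → 0 ≤ Φ t) ∧ MonotoneOn Φ (Ici (0 : ℝ)) ∧
    Tendsto Φ atTop atTop ∧ ∀ x x' : X, dY (f x) (f x') ≤ Φ (dX x x')

/-- `f` is a coarse equivalence from `(s, dX)` to `(t, dY)`: a coarse embedding whose image
is coarsely dense in `t`. -/
def IsCoarseEquivOn (dX : X → X → ℝ) (dY : Y → Y → ℝ) (s : Set X) (t : Set Y) (f : X → Y) :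
    Prop :=
  MapsTo f s t ∧
  (∃ Φm Φp : ℝ → ℝ, (∀ u, 0 ≤ u → 0 ≤ Φm u) ∧ (∀ u, 0 ≤ u → 0 ≤ Φp u) ∧
    MonotoneOn Φm (Ici (0 : ℝ)) ∧ MonotoneOn Φp (Ici (0 : ℝ)) ∧
    Tendsto Φm atTop atTop ∧ Tendsto Φp atTop atTop ∧
    ∀ x ∈ s, ∀ x' ∈ s,
      Φm (dX x x') ≤ dY (f x) (f x') ∧ dY (f x) (f x') ≤ Φp (dX x x')) ∧
  ∃ L : ℝ, 0 < L ∧ ∀ y ∈ t, ∃ x ∈ s, dY y (f x) < L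

/-- `f : (X, dX) → (Y, dY)` is a coarse equivalence. -/
def IsCoarseEquiv (dX : X → X → ℝ) (dY : Y → Y → ℝ) (f : X → Y) : Prop :=
  IsCoarseEquivOn dX dY univ univ f

end Defs

section Helpers

variable {X Y G H : Type*}

theorem H_one_le_ncard {k : ℕ} (s : Set (Fin k)) : 1 ≤ s.ncard ↔ s.Nonempty :=
  Set.ncard_pos (Set.toFinite s)

/-- one step of an `r`-path inside `A` -/
def HStep (d : X → X → ℝ) (r : ℝ) (A : Set X) (a b : X) : Prop := a ∈ A ∧ b ∈ A ∧ d a b < r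

/-- `r`-path connectedness inside `A` -/
def HReach (d : X → X → ℝ) (r : ℝ) (A : Set X) : X → X → Prop :=
  Relation.ReflTransGen (HStep d r A)

/-- `r`-components of `A` are `D`-bounded -/
def HCB (d : X → X → ℝ) (r D : ℝ) (A : Set X) : Prop := ∀ x y, HReach d r A x y → d x y ≤ D

/-- colored covers with multiplicity -/
def HGood (d : X → X → ℝ) (s : Set X) (r D : ℝ) (k j : ℕ) : Prop :=
  ∃ A : Fin k → Set X, (∀ i, HCB d r D (A i)) ∧ ∀ x ∈ s, j ≤ {i | x ∈ A i}.ncard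

theorem HReach.symm {d : X → X → ℝ} (hd : IsMetric d) {r : ℝ} {A : Set X} {x y : X}
    (h : HReach d r A x y) : HReach d r A y x := by
  induction h with
  | refl => exact Relation.ReflTransGen.refl
  | tail _ h ih =>
    exact Relation.ReflTransGen.head ⟨h.2.1, h.1, by rw [hd.2.2.1]; exact h.2.2⟩ ih

theorem HReach.mono {d : X → X → ℝ} {r r' : ℝ} {A A' : Set X} {x y : X}
    (h : HReach d r A x y) (hr : r ≤ r') (hA : A ⊆ A') : HReach d r' A' x y := by
  induction h with
  | refl => exact Relation.ReflTransGen.refl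
  | tail _ h ih =>
    exact Relation.ReflTransGen.tail ih ⟨hA h.1, hA h.2.1, h.2.2.trans_le hr⟩

theorem HReach.mem {d : X → X → ℝ} {r : ℝ} {A : Set X} {x y : X}
    (h : HReach d r A x y) (hx : x ∈ A) : y ∈ A := by
  induction h with
  | refl => exact hx
  | tail _ h _ => exact h.2.1

theorem HCB.mono {d : X → X → ℝ} {r r' D D' : ℝ} {A A' : Set X}
    (h : HCB d r' D A') (hr : r ≤ r') (hA : A ⊆ A') (hD : D ≤ D') : HCB d r D' A :=
  fun x y hxy => (h x y (hxy.mono hr hA)).trans hD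

theorem HCB.nonneg {d : X → X → ℝ} (hd : IsMetric d) {r D : ℝ} {A : Set X}
    (h : HCB d r D A) (x : X) : 0 ≤ D :=
  (hd.1 x x).trans (h x x Relation.ReflTransGen.refl)

/-- from families to components -/
theorem HGood.of_asdim {d : X → X → ℝ} (hd : IsMetric d) {s : Set X} {n : ℕ}
    (h : ASDimLE d s n) (r : ℝ) (hr : 0 < r) : ∃ D, HGood d s r D (n + 1) 1 := by
  obtain ⟨D, hD, U, hUs, hcov, hbd, hdis⟩ := h r hr
  refine ⟨D, fun i => ⋃₀ U i, ?_, ?_⟩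
  · intro i x y hxy
    have key : x = y ∨ ∃ u ∈ U i, x ∈ u ∧ y ∈ u := by
      induction hxy with
      | refl => exact Or.inl rfl
      | @tail b c _ hbc ih =>
        right
        obtain ⟨⟨u, hu, hbu⟩, ⟨v, hv, hcv⟩, hlt⟩ := hbc
        have huv : u = v := by
          by_contra hne
          exact absurd (hdis i u hu v hv hne b hbu c hcv) (not_le.2 hlt)
        subst huv
        rcases ih with rfl | ⟨w, hw, hxw, hbw⟩
        · exact ⟨u, hu, hbu, hcv⟩
        · have hwu : w = u := by
            by_contra hne
            have := hdis i w hw u hu hne b hbw b hbu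
            rw [(hd.2.1 b b).2 rfl] at this
            linarith
          subst hwu
          exact ⟨w, hw, hxw, hcv⟩
    rcases key with rfl | ⟨u, hu, hx, hy⟩
    · rw [(hd.2.1 x x).2 rfl]; exact hD.le
    · exact hbd i u hu x hx y hy
  · intro x hx
    obtain ⟨i, hi⟩ := mem_iUnion.1 (hcov hx)
    rw [H_one_le_ncard]
    exact ⟨i, hi⟩

/-- from components to families -/
theorem HGood.to_asdim {d : X → X → ℝ} (hd : IsMetric d) {s : Set X} {n : ℕ}
    (h : ∀ r : ℝ, 0 < r → ∃ D, HGood d s r D (n + 1) 1) : ASDimLE d s n := by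
  intro r hr
  obtain ⟨D, A, hA, hcov⟩ := h r hr
  refine ⟨max D 1, by positivity, fun i => {u | ∃ x ∈ A i ∩ s, u = {y | HReach d r (A i ∩ s) x y}},
    ?_, ?_, ?_, ?_⟩
  · rintro i u ⟨x, hx, rfl⟩ y hy
    exact (HReach.mem hy hx).2
  · intro x hx
    have := hcov x hx
    rw [H_one_le_ncard] at this
    obtain ⟨i, hi⟩ := this
    exact mem_iUnion.2 ⟨i, _, ⟨x, ⟨hi, hx⟩, rfl⟩, Relation.ReflTransGen.refl⟩
  · rintro i u ⟨x, hx, rfl⟩ y hy z hz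
    exact (hA i y z (HReach.mono ((HReach.symm hd hy).trans hz) le_rfl inter_subset_left)).trans
      (le_max_left _ _)
  · rintro i u ⟨x, hx, rfl⟩ v ⟨x', hx', rfl⟩ hne y hy z hz
    by_contra hlt
    push Not at hlt
    apply hne
    have hyz : HReach d r (A i ∩ s) y z :=
      Relation.ReflTransGen.single ⟨HReach.mem hy hx, HReach.mem hz hx', hlt⟩
    have hxx : HReach d r (A i ∩ s) x x' := (hy.trans hyz).trans (HReach.symm hd hz)
    ext w
    exact ⟨fun hw => (HReach.symm hd hxx).trans hw, fun hw => hxx.trans hw⟩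

/-- Kolmogorov trick -/
theorem HGood.succ {d : X → X → ℝ} (hd : IsMetric d) {s : Set X} {k j : ℕ} (hj : 1 ≤ j)
    (h : ∀ r : ℝ, 0 < r → ∃ D, HGood d s r D k j) :
    ∀ r : ℝ, 0 < r → ∃ D, HGood d s r D (k + 1) (j + 1) := by
  intro r hr
  obtain ⟨D, A, hA, hcov⟩ := h (3 * r) (by positivity)
  let A' : Fin k → Set X := fun i => {x | ∃ a ∈ A i, d x a < r}
  let W : Set X := {x | x ∈ s ∧ ∀ i, x ∈ A' i → x ∈ A i}
  have hd0 : ∀ x, d x x = 0 := fun x => (hd.2.1 x x).2 rfl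
  have hAA' : ∀ i, A i ⊆ A' i := fun i x hx => ⟨x, hx, by rw [hd0]; exact hr⟩
  have hmax := le_max_left D 0
  refine ⟨max D 0 + 2 * r, Fin.cons W A', ?_, ?_⟩
  · intro i
    refine Fin.cases ?_ (fun i => ?_) i
    · intro x y hxy
      simp only [Fin.cons_zero] at hxy
      have key : ∀ i, x ∈ A i → y ∈ A i ∧ HReach d (3 * r) (A i) x y := by
        intro i hx
        induction hxy with
        | refl => exact ⟨hx, Relation.ReflTransGen.refl⟩
        | @tail b c _ hbc ih =>
          obtain ⟨hb, hc, hlt⟩ := hbc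
          have hcA : c ∈ A i := hc.2 i ⟨b, ih.1, by rw [hd.2.2.1]; exact hlt⟩
          exact ⟨hcA, ih.2.tail ⟨ih.1, hcA, by linarith⟩⟩
      rcases Relation.ReflTransGen.cases_head hxy with rfl | ⟨c, hc, -⟩
      · rw [hd0]; positivity
      · have := hj.trans (hcov x hc.1.1)
        rw [H_one_le_ncard] at this
        obtain ⟨i, hi⟩ := this
        have := hA i x y (key i hi).2
        linarith
    · intro x y hxy
      simp only [Fin.cons_succ] at hxy
      have key : x = y ∨ (∀ a ∈ A i, d x a < r → ∀ b ∈ A i, d y b < r →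
          HReach d (3 * r) (A i) a b) ∧ x ∈ A' i ∧ y ∈ A' i := by
        have aux : ∀ x y, d x y < r → ∀ a ∈ A i, d x a < r → ∀ b ∈ A i, d y b < r →
          HReach d (3 * r) (A i) a b := by
          intro x y hxy a ha hxa b hb hyb
          refine Relation.ReflTransGen.single ⟨ha, hb, ?_⟩
          have h1 := hd.2.2.2 a x b
          have h2 := hd.2.2.2 x y b
          rw [hd.2.2.1 a x] at h1
          linarith
        induction hxy with
        | refl => exact Or.inl rfl
        | @tail b c _ hbc ih =>
          right
          obtain ⟨hb, hc, hlt⟩ := hbc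
          rcases ih with rfl | ⟨ih, hx, -⟩
          · exact ⟨aux _ _ hlt, hb, hc⟩
          · refine ⟨?_, hx, hc⟩
            intro a ha hxa e he hce
            obtain ⟨a', ha', hba'⟩ := hb
            exact (ih a ha hxa a' ha' hba').trans (aux _ _ hlt a' ha' hba' e he hce)
      have hD := (hA i).nonneg hd x
      rcases key with rfl | ⟨key, ⟨a, ha, hxa⟩, ⟨b, hb, hyb⟩⟩
      · rw [hd0]; linarith
      · have h0 := hA i a b (key a ha hxa b hb hyb)
        have h1 := hd.2.2.2 x a y
        have h2 := hd.2.2.2 a b y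
        rw [hd.2.2.1 b y] at h2
        linarith
  · intro x hx
    have hc := hcov x hx
    by_cases hW : x ∈ W
    · have hsub : insert 0 (Fin.succ '' {i | x ∈ A i}) ⊆
          {i | x ∈ (Fin.cons W A' : Fin (k + 1) → Set X) i} := by
        rintro i (rfl | ⟨i, hi, rfl⟩)
        · simpa using hW
        · simpa using hAA' i hi
      have := Set.ncard_le_ncard hsub (Set.toFinite _)
      rw [Set.ncard_insert_of_notMem (by simp), Set.ncard_image_of_injective _
        (Fin.succ_injective k)] at this
      omega
    · have : ∃ i, x ∈ A' i ∧ x ∉ A i := by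
        by_contra hcon
        push Not at hcon
        exact hW ⟨hx, hcon⟩
      obtain ⟨i0, h1, h2⟩ := this
      have hsub : (Fin.succ '' (insert i0 {i | x ∈ A i})) ⊆
          {i | x ∈ (Fin.cons W A' : Fin (k + 1) → Set X) i} := by
        rintro i ⟨i, (rfl | hi), rfl⟩
        · simpa using h1
        · simpa using hAA' i hi
      have := Set.ncard_le_ncard hsub (Set.toFinite _)
      rw [Set.ncard_image_of_injective _ (Fin.succ_injective k),
        Set.ncard_insert_of_notMem (by simpa using h2)] at this
      omega

theorem HGood.add {d : X → X → ℝ} (hd : IsMetric d) {s : Set X} {n : ℕ}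
    (h : ASDimLE d s n) (p : ℕ) :
    ∀ r : ℝ, 0 < r → ∃ D, HGood d s r D (n + 1 + p) (1 + p) := by
  induction p with
  | zero => exact HGood.of_asdim hd h
  | succ p ih => exact HGood.succ hd (j := 1 + p) (by omega) ih

theorem HCB.union {d : X → X → ℝ} (hd : IsMetric d) {r E r' D : ℝ} (hr : 0 < r) {P Q : Set X}
    (hP : HCB d r E P) (hQ : HCB d r' D Q) (hr' : E + 2 * r ≤ r') :
    HCB d r (2 * (D + r + E)) (P ∪ Q) := by
  have hd0 : ∀ x, d x x = 0 := fun x => (hd.2.1 x x).2 rfl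
  have key : ∀ x y, x ∈ Q → HReach d r (P ∪ Q) x y → d x y ≤ D + r + E := by
    intro x y hx hxy
    have hE := hP.nonneg hd x
    have : ∃ q ∈ Q, HReach d r' Q x q ∧ (y = q ∨ ∃ p ∈ P, d q p < r ∧ HReach d r P p y) := by
      induction hxy with
      | refl => exact ⟨x, hx, Relation.ReflTransGen.refl, Or.inl rfl⟩
      | @tail b c _ hbc ih =>
        obtain ⟨q, hq, hxq, ih⟩ := ih
        obtain ⟨hb, hc, hlt⟩ := hbc
        rcases hc with hc | hc
        · rcases ih with rfl | ⟨p, hp, hqp, hpb⟩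
          · exact ⟨b, hq, hxq, Or.inr ⟨c, hc, hlt, Relation.ReflTransGen.refl⟩⟩
          · exact ⟨q, hq, hxq, Or.inr ⟨p, hp, hqp, hpb.tail ⟨HReach.mem hpb hp, hc, hlt⟩⟩⟩
        · refine ⟨c, hc, hxq.tail ⟨hq, hc, ?_⟩, Or.inl rfl⟩
          rcases ih with rfl | ⟨p, hp, hqp, hpb⟩
          · linarith
          · have h0 := hP p b hpb
            have h1 := hd.2.2.2 q p c
            have h2 := hd.2.2.2 p b c
            linarith
    obtain ⟨q, hq, hxq, h⟩ := this
    have h0 := hQ x q hxq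
    rcases h with rfl | ⟨p, hp, hqp, hpy⟩
    · linarith
    · have h1 := hP p y hpy
      have h2 := hd.2.2.2 x q y
      have h3 := hd.2.2.2 q p y
      linarith
  intro x y hxy
  have hE := hP.nonneg hd x
  have hD := hQ.nonneg hd x
  have : HReach d r P x y ∨ ∃ q ∈ Q, HReach d r (P ∪ Q) q x ∧ HReach d r (P ∪ Q) q y := by
    induction hxy with
    | refl => exact Or.inl Relation.ReflTransGen.refl
    | @tail b c hxb hbc ih =>
      rcases ih with ih | ⟨q, hq, h1, h2⟩
      · obtain ⟨hb, hc, hlt⟩ := id hbc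
        rcases hb with hb | hb
        · rcases hc with hc | hc
          · exact Or.inl (ih.tail ⟨hb, hc, hlt⟩)
          · exact Or.inr ⟨c, hc, HReach.symm hd (hxb.tail hbc), Relation.ReflTransGen.refl⟩
        · exact Or.inr ⟨b, hb, HReach.symm hd hxb, Relation.ReflTransGen.single hbc⟩
      · exact Or.inr ⟨q, hq, h1, h2.tail hbc⟩
  rcases this with h | ⟨q, hq, h1, h2⟩
  · have := hP x y h
    linarith
  · have h3 := key q x hq h1
    have h4 := key q y hq h2
    have h5 := hd.2.2.2 x q y
    rw [hd.2.2.1 x q] at h5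
    linarith

theorem H_ball_finite {d : X → X → ℝ} (hp : IsProperMetric d) (x : X) (r : ℝ) :
    {y | d x y ≤ r}.Finite := by
  let _ : TopologicalSpace X := ⊥
  have : DiscreteTopology X := ⟨rfl⟩
  exact (isCompact_iff_finite).1 (hp x r)

/-- greedy coloring -/
theorem H_coloring [Countable H] [Group H] {d : H → H → ℝ} (hd : IsMetric d)
    (hli : IsLeftInvariant d) (hp : IsProperMetric d) (S : ℝ) :
    ∃ (M : ℕ) (χ : H → ℕ), (∀ h, χ h < M) ∧ ∀ h h', d h h' ≤ S → χ h = χ h' → h = h' := by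
  classical
  obtain ⟨e, he⟩ := exists_injective_nat H
  have hfin := H_ball_finite hp 1 S
  let N := hfin.toFinset.card
  have ex : ∀ (h : H) (g : H → ℕ), ∃ n < N + 1, ∀ h', d h h' ≤ S → g h' ≠ n := by
    intro h g
    obtain ⟨n, hn, hn'⟩ := Finset.exists_mem_notMem_of_card_lt_card
      (s := hfin.toFinset.image (fun b => g (h * b))) (t := Finset.range (N + 1))
      (by rw [Finset.card_range]; exact Nat.lt_succ_of_le Finset.card_image_le)
    refine ⟨n, Finset.mem_range.1 hn, fun h' hh' hg => hn' ?_⟩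
    refine Finset.mem_image.2 ⟨h⁻¹ * h', ?_, by simpa using hg⟩
    simp only [Set.Finite.mem_toFinset, mem_setOf_eq]
    rw [← hli h]
    simpa using hh'
  choose c hcN hc using ex
  have hwf : WellFounded (fun a b : H => e a < e b) := InvImage.wf e wellFounded_lt
  let χ : H → ℕ := hwf.fix (fun h ih => c h (fun h' => if hlt : e h' < e h then ih h' hlt else N + 1))
  have hχ : ∀ h, χ h = c h (fun h' => if e h' < e h then χ h' else N + 1) := by
    intro h
    have := hwf.fix_eq
      (fun (h : H) (ih : ∀ y, e y < e h → ℕ) =>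
        c h (fun h' => if hlt : e h' < e h then ih h' hlt else N + 1)) h
    simpa using this
  have main : ∀ h h', e h' < e h → d h h' ≤ S → χ h ≠ χ h' := by
    intro h h' hlt hS heq
    have := hc h (fun h' => if e h' < e h then χ h' else N + 1) h' hS
    rw [← hχ h] at this
    simp only [hlt, if_true] at this
    exact this heq.symm
  refine ⟨N + 1, χ, fun h => by rw [hχ]; exact hcN _ _, fun h h' hS heq => ?_⟩
  rcases lt_trichotomy (e h) (e h') with hlt | heq' | hlt
  · exact absurd heq.symm (main h' h hlt (by rw [hd.2.2.1]; exact hS))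
  · exact he heq'
  · exact absurd heq (main h h' hlt hS)

/-- sets with control over `S`-bounded sets, using fibrewise control -/
theorem H_global {d : X → X → ℝ} (hd : IsMetric d) [Nonempty X] {f : X → H} {d' : H → H → ℝ}
    {k j : ℕ}
    (hfib : ∀ r : ℝ, 0 < r → ∃ D, ∃ B : Fin k → Set X,
      (∀ i h, HCB d r D (B i ∩ f ⁻¹' {h})) ∧ ∀ x, j ≤ {i | x ∈ B i}.ncard)
    {S : ℝ} {χ : H → ℕ} (hχ : ∀ h h', d' h h' ≤ S → χ h = χ h' → h = h')
    {r : ℝ} (hr : 0 < r) (c : ℕ) :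
    ∃ E, 0 ≤ E ∧ ∃ A : Fin k → Set X, (∀ x, χ (f x) < c → j ≤ {i | x ∈ A i}.ncard) ∧
      ∀ V : Set H, (∀ h ∈ V, ∀ h' ∈ V, d' h h' ≤ S) → ∀ i, HCB d r E (A i ∩ f ⁻¹' V) := by
  have hd0 : ∀ x, d x x = 0 := fun x => (hd.2.1 x x).2 rfl
  have hempty : ∀ (r D : ℝ), 0 ≤ D → HCB d r D ∅ := by
    intro r D hD x y hxy
    rcases Relation.ReflTransGen.cases_head hxy with rfl | ⟨c, hc, -⟩
    · rw [hd0]; exact hD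
    · exact absurd hc.1 (by simp)
  induction c with
  | zero =>
    refine ⟨0, le_rfl, fun _ => ∅, fun x hx => absurd hx (by simp), fun V hV i => ?_⟩
    rw [empty_inter]
    exact hempty _ _ le_rfl
  | succ c ih =>
    obtain ⟨E, hE, A, hcov, hA⟩ := ih
    obtain ⟨D, B, hB, hBc⟩ := hfib (E + 2 * r) (by positivity)
    have hD : HCB d (E + 2 * r) (max D 0) ∅ := hempty _ _ (le_max_right _ _)
    refine ⟨2 * (max D 0 + r + E), by positivity, fun i => A i ∪ (B i ∩ {x | χ (f x) = c}), ?_, ?_⟩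
    · intro x hx
      rcases Nat.lt_succ_iff_lt_or_eq.1 hx with hx | hx
      · exact (hcov x hx).trans (Set.ncard_le_ncard (fun i hi => Or.inl hi) (Set.toFinite _))
      · exact (hBc x).trans (Set.ncard_le_ncard (fun i hi => Or.inr ⟨hi, hx⟩) (Set.toFinite _))
    · intro V hV i
      rw [union_inter_distrib_right]
      refine HCB.union hd hr (hA V hV i) ?_ le_rfl
      by_cases hne : ∃ h ∈ V, χ h = c
      · obtain ⟨h, hh, hhc⟩ := hne
        refine (hB i h).mono le_rfl ?_ (le_max_left _ _)
        rintro x ⟨⟨hx, hxc⟩, hxV⟩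
        exact ⟨hx, hχ _ _ (hV _ hxV _ hh) (hxc.trans hhc.symm)⟩
      · refine hD.mono le_rfl ?_ le_rfl
        rintro x ⟨⟨hx, hxc⟩, hxV⟩
        exact hne ⟨f x, hxV, hxc⟩

theorem H_asdim_cases (d : X → X → ℝ) (s : Set X) :
    asdim d s = ⊤ ∨ ∃ n : ℕ, asdim d s = n ∧ ASDimLE d s n := by
  by_cases h : {n | ASDimLE d s n}.Nonempty
  · right
    have := csInf_mem (h.image (fun n : ℕ => (n : ℕ∞)))
    obtain ⟨n, hn, heq⟩ := this
    exact ⟨n, heq.symm, hn⟩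
  · left
    rw [Set.not_nonempty_iff_eq_empty] at h
    simp [asdim, h]

theorem H_main [Group G] [Group H] [Countable H]
    (Ξ : Set G) (Λ : Set H)
    (f : G → H) (hqm : IsQuasimorphism f) (hsym : IsSymmetricMap f)
    (hmaps : f '' Ξ ⊆ Λ)
    (d : G → G → ℝ) (hd : IsMetric d) (hdli : IsLeftInvariant d) (hdp : IsProperMetric d)
    (d' : H → H → ℝ) (hd' : IsMetric d') (hd'li : IsLeftInvariant d')
    (hd'p : IsProperMetric d') (m n : ℕ) (hm : ASDimLE d' Λ m)
    (hn : ASDimLE d (f ⁻¹' defectSet f) n) : ASDimLE d Ξ (m + n) := by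
  apply HGood.to_asdim hd
  intro r hr
  -- coarse Lipschitz control
  obtain ⟨ρ, hρ, hlip⟩ : ∃ ρ : ℝ, 0 < ρ ∧ ∀ x y, d x y < r → d' (f x) (f y) < ρ := by
    have hfin : ((fun p : G × H => d' 1 (f p.1 * p.2⁻¹)) ''
        ({y | d 1 y ≤ r} ×ˢ defectSet f)).Finite :=
      ((H_ball_finite hdp 1 r).prod hqm).image _
    obtain ⟨b, hb⟩ := hfin.bddAbove
    refine ⟨max b 0 + 1, by positivity, fun x y hxy => ?_⟩
    have hmem : d' (f x) (f y) ≤ b := by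
      apply hb
      refine ⟨(x⁻¹ * y, (f y)⁻¹ * (f x⁻¹)⁻¹ * f (x⁻¹ * y)), ⟨?_, x⁻¹, y, rfl⟩, ?_⟩
      · show d 1 (x⁻¹ * y) ≤ r
        rw [← hdli x]
        simpa using hxy.le
      · show d' 1 _ = _
        rw [← hd'li (f x)]
        rw [hsym x]
        congr 1 <;> group
    have := le_max_left b 0
    linarith
  obtain ⟨S, Yf, hYf, hYc⟩ := HGood.add hd' hm n ρ hρ
  obtain ⟨M, χ, hχM, hχ⟩ := H_coloring hd' hd'li hd'p S
  have hfib : ∀ r : ℝ, 0 < r → ∃ D, ∃ B : Fin (m + 1 + n) → Set G,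
      (∀ i h, HCB d r D (B i ∩ f ⁻¹' {h})) ∧ ∀ x, 1 + m ≤ {i | x ∈ B i}.ncard := by
    intro r hr
    have hg := HGood.add hd hn m r hr
    rw [show n + 1 + m = m + 1 + n by omega] at hg
    obtain ⟨D, A, hA, hAc⟩ := hg
    let σ : H → G := Function.invFun f
    have hσ : ∀ x, f (σ (f x)) = f x := fun x => Function.invFun_eq ⟨x, rfl⟩
    refine ⟨D, fun i => {z | (σ (f z))⁻¹ * z ∈ A i}, ?_, ?_⟩
    · intro i h x y hxy
      rw [← hdli (σ h)⁻¹]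
      apply hA i
      refine Relation.ReflTransGen.lift (fun z => (σ h)⁻¹ * z) ?_ _ _ hxy
      rintro a b ⟨⟨ha, hah⟩, ⟨hb, hbh⟩, hlt⟩
      simp only [mem_preimage, mem_singleton_iff] at hah hbh
      simp only [mem_setOf_eq, hah] at ha
      simp only [mem_setOf_eq, hbh] at hb
      exact ⟨ha, hb, by rw [hdli]; exact hlt⟩
    · intro x
      apply hAc
      refine ⟨(σ (f x))⁻¹, x, ?_⟩
      rw [hsym (σ (f x)), hσ]
      group
  obtain ⟨E, hE, A, hAc, hA⟩ := H_global hd hfib hχ hr M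
  refine ⟨E, ?_⟩
  rw [show m + n + 1 = m + 1 + n by omega]
  refine ⟨fun i => A i ∩ f ⁻¹' Yf i, ?_, ?_⟩
  · intro i x y hxy
    let V : Set H := {h | HReach d' ρ (Yf i) (f x) h}
    have hV : ∀ h ∈ V, ∀ h' ∈ V, d' h h' ≤ S := fun h hh h' hh' =>
      hYf i h h' ((HReach.symm hd' hh).trans hh')
    apply hA V hV i
    have : HReach d r (A i ∩ f ⁻¹' V) x y ∧ f y ∈ V := by
      induction hxy with
      | refl => exact ⟨Relation.ReflTransGen.refl, Relation.ReflTransGen.refl⟩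
      | @tail b c _ hbc ih =>
        obtain ⟨⟨hb, hb'⟩, ⟨hc, hc'⟩, hlt⟩ := hbc
        have hcV : f c ∈ V := Relation.ReflTransGen.tail ih.2 ⟨hb', hc', hlip _ _ hlt⟩
        exact ⟨ih.1.tail ⟨⟨hb, ih.2⟩, ⟨hc, hcV⟩, hlt⟩, hcV⟩
    exact this.1
  · intro x hx
    have h1 := hYc (f x) (hmaps ⟨x, hx, rfl⟩)
    have h2 := hAc x (hχM _)
    rw [H_one_le_ncard]
    by_contra hcon
    have hdisj : Disjoint {i | f x ∈ Yf i} {i | x ∈ A i} := by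
      rw [Set.disjoint_left]
      intro i hi hi'
      exact hcon ⟨i, hi', hi⟩
    have h3 := Set.ncard_union_eq hdisj (Set.toFinite _) (Set.toFinite _)
    have h4 := Set.ncard_le_card ({i | f x ∈ Yf i} ∪ {i | x ∈ A i})
    simp only [Nat.card_eq_fintype_card, Fintype.card_fin] at h4
    omega

end Helpers

/-- Hurewicz-type formula for symmetric unital quasimorphisms of countable
approximate groups: `asdim Ξ ≤ asdim Λ + asdim (f⁻¹(D(f)))`. Here the approximate groups
`(Ξ, Ξ^∞)` and `(Λ, Λ^∞)` are modelled by countable groups `G = Ξ^∞` and `H = Λ^∞`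
generated by the approximate subgroups `Ξ` and `Λ`. -/
theorem asdim_le_asdim_add_asdim_preimage_defect
    {G H : Type*} [Group G] [Group H] [Countable G] [Countable H]
    (Ξ : Set G) (Λ : Set H)
    (hΞ : IsApproxSubgroup Ξ) (hΛ : IsApproxSubgroup Λ)
    (hΞgen : Subgroup.closure Ξ = ⊤) (hΛgen : Subgroup.closure Λ = ⊤)
    (f : G → H) (hqm : IsQuasimorphism f) (hsym : IsSymmetricMap f) (hun : IsUnitalMap f)
    (hmaps : f '' Ξ ⊆ Λ)
    (d : G → G → ℝ) (hd : IsMetric d) (hdli : IsLeftInvariant d) (hdp : IsProperMetric d)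
    (d' : H → H → ℝ) (hd' : IsMetric d') (hd'li : IsLeftInvariant d')
    (hd'p : IsProperMetric d') :
    asdim d Ξ ≤ asdim d' Λ + asdim d (f ⁻¹' defectSet f) := by
  rcases H_asdim_cases d' Λ with h | ⟨m, hm, hm'⟩
  · rw [h]; simp
  rcases H_asdim_cases d (f ⁻¹' defectSet f) with h | ⟨n, hn, hn'⟩
  · rw [h]; simp
  rw [hm, hn]
  exact sInf_le ⟨m + n, H_main Ξ Λ f hqm hsym hmaps d hd hdli hdp d' hd' hd'li hd'p m n hm' hn',
    by simp⟩
end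

section
/- Let (Ξ, Ξ^∞) and (Λ, Λ^∞) be countable approximate groups, and let f : (Ξ, Ξ^∞) → (Λ, Λ^∞) be a symmetric quasimorphism. Then the restriction f₁ = f|_Ξ : Ξ → Λ is coarsely Lipschitz with respect to the canonical metrics on Ξ and Λ, i.e. the restrictions of any left-invariant proper metrics on Ξ^∞ and Λ^∞. -/
open Set Filter Pointwise

/-- the restriction to `Ξ` of a symmetric quasimorphism of countable approximate
groups is coarsely Lipschitz with respect to the canonical metrics, i.e. the restrictions of
any left-invariant proper metrics on the enveloping groups. -/
theorem restriction_coarselyLipschitz_of_symmetric_quasimorphism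
    {G H : Type*} [Group G] [Group H] [Countable G] [Countable H]
    (Ξ : Set G) (Λ : Set H)
    (hΞ : IsApproxSubgroup Ξ) (hΛ : IsApproxSubgroup Λ)
    (hΞgen : Subgroup.closure Ξ = ⊤) (hΛgen : Subgroup.closure Λ = ⊤)
    (f : G → H) (hqm : IsQuasimorphism f) (hsym : IsSymmetricMap f)
    (hmaps : f '' Ξ ⊆ Λ)
    (d : G → G → ℝ) (hd : IsMetric d) (hdli : IsLeftInvariant d) (hdp : IsProperMetric d)
    (d' : H → H → ℝ) (hd' : IsMetric d') (hd'li : IsLeftInvariant d')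
    (hd'p : IsProperMetric d') :
    IsCoarselyLipschitzOn d d' Ξ f := by
  obtain ⟨hd0, hd1, hd2, hd3⟩ := hd
  obtain ⟨hd0', hd1', hd2', hd3'⟩ := hd'
  let S : ℝ → Set ℝ := fun t => {r | ∃ x x' : G, d x x' ≤ t ∧ r = d' (f x) (f x')}
  have hS : ∀ t, (S t).Finite := by
    intro t
    have hB : {y : G | d 1 y ≤ t}.Finite := by
      let _ : TopologicalSpace G := ⊥
      have _ : DiscreteTopology G := ⟨rfl⟩
      exact (hdp 1 t).finite_of_discrete
    refine ((hB.prod hqm).image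
      (fun p : G × H => d' 1 (f p.1 * p.2))).subset ?_
    rintro r ⟨x, x', hxx, rfl⟩
    refine ⟨(x⁻¹ * x', (f (x⁻¹ * x'))⁻¹ * (f x)⁻¹ * f (x * (x⁻¹ * x'))), ⟨?_, ?_⟩, ?_⟩
    · have h := hdli x⁻¹ x x'
      rw [inv_mul_cancel] at h
      change d 1 (x⁻¹ * x') ≤ t
      rw [h]
      exact hxx
    · exact ⟨x, x⁻¹ * x', rfl⟩
    · have h := hd'li (f x)⁻¹ (f x) (f x')
      rw [inv_mul_cancel] at h
      simp only [mul_inv_cancel_left, mul_assoc]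
      exact h
  have hmem : ∀ t, 0 ≤ t → (0 : ℝ) ∈ S t := by
    intro t ht
    refine ⟨1, 1, ?_, ?_⟩
    · rw [(hd1 1 1).2 rfl]
      exact ht
    · exact ((hd1' _ _).2 rfl).symm
  have hnn : ∀ t, 0 ≤ t → 0 ≤ sSup (S t) :=
    fun t ht => le_csSup (hS t).bddAbove (hmem t ht)
  refine ⟨fun t => t + sSup (S t), fun t ht => add_nonneg ht (hnn t ht), ?_, ?_, ?_⟩
  · intro s hs t ht hst
    refine add_le_add hst (csSup_le_csSup (hS t).bddAbove ⟨0, hmem s hs⟩ ?_)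
    rintro r ⟨x, x', h, rfl⟩
    exact ⟨x, x', h.trans hst, rfl⟩
  · refine tendsto_atTop_mono' atTop ?_ tendsto_id
    filter_upwards [eventually_ge_atTop (0 : ℝ)] with t ht
    have := hnn t ht
    simp only [id]
    linarith
  · intro x _ x' _
    have h1 : d' (f x) (f x') ≤ sSup (S (d x x')) :=
      le_csSup (hS _).bddAbove ⟨x, x', le_rfl, rfl⟩
    have h2 := hd0 x x'
    change _ ≤ d x x' + sSup (S (d x x'))
    linarith
end

section
/- Let f : G → H be a symmetric and unital quasimorphism between groups, and let Ξ be an approximate subgroup of G. Then f(Ξ) is an approximate subgroup of H. More precisely, f(Ξ) is symmetric and unital, and if F ⊆ G is a finite set with Ξ² ⊆ ΞF, then f(Ξ)² ⊆ f(Ξ) · (f(F)D(f)D(f)⁻¹), where f(F)D(f)D(f)⁻¹ is finite. -/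
open Set Filter Pointwise

/-- the image of an approximate subgroup under a symmetric unital quasimorphism
is an approximate subgroup; more precisely `f(Ξ)` is symmetric and unital, and if
`Ξ² ⊆ ΞF` with `F` finite, then `f(Ξ)² ⊆ f(Ξ) · (f(F)D(f)D(f)⁻¹)` with
`f(F)D(f)D(f)⁻¹` finite. -/
theorem image_isApproxSubgroup_of_symmetric_unital_quasimorphism
    {G H : Type*} [Group G] [Group H]
    (f : G → H) (hqm : IsQuasimorphism f) (hsym : IsSymmetricMap f) (hun : IsUnitalMap f)
    (Ξ : Set G) (hΞ : IsApproxSubgroup Ξ) :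
    IsApproxSubgroup (f '' Ξ) ∧ (f '' Ξ)⁻¹ = f '' Ξ ∧ (1 : H) ∈ f '' Ξ ∧
      ∀ F : Set G, F.Finite → Ξ * Ξ ⊆ Ξ * F →
        (f '' Ξ) * (f '' Ξ) ⊆ (f '' Ξ) * ((f '' F) * defectSet f * (defectSet f)⁻¹) ∧
          ((f '' F) * defectSet f * (defectSet f)⁻¹).Finite := by
  have hsymm : (f '' Ξ)⁻¹ = f '' Ξ := by
    ext h
    constructor
    · rintro ⟨x, hx, hxh⟩
      refine ⟨x⁻¹, ?_, ?_⟩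
      · rw [← hΞ.1]
        simpa using hx
      · rw [hsym, hxh, inv_inv]
    · rintro ⟨x, hx, rfl⟩
      refine ⟨x⁻¹, ?_, hsym x⟩
      rw [← hΞ.1]
      simpa using hx
  have hone : (1 : H) ∈ f '' Ξ := ⟨1, hΞ.2.1, hun⟩
  have key : ∀ F : Set G, F.Finite → Ξ * Ξ ⊆ Ξ * F →
        (f '' Ξ) * (f '' Ξ) ⊆ (f '' Ξ) * ((f '' F) * defectSet f * (defectSet f)⁻¹) ∧
          ((f '' F) * defectSet f * (defectSet f)⁻¹).Finite := by
    intro F hF hsub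
    refine ⟨?_, ((hF.image f).mul hqm).mul (Set.Finite.inv hqm)⟩
    rintro _ ⟨_, ⟨x, hx, rfl⟩, _, ⟨y, hy, rfl⟩, rfl⟩
    obtain ⟨z, hz, c, hc, hzc⟩ := hsub (Set.mul_mem_mul hx hy)
    have hzc' : z * c = x * y := hzc
    have e : f x * f y = f z * (f c * ((f c)⁻¹ * (f z)⁻¹ * f (z * c)) *
        ((f y)⁻¹ * (f x)⁻¹ * f (x * y))⁻¹) := by
      rw [hzc']
      group
    show f x * f y ∈ _
    rw [e]
    exact Set.mul_mem_mul ⟨z, hz, rfl⟩ (Set.mul_mem_mul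
      (Set.mul_mem_mul ⟨c, hc, rfl⟩ ⟨z, c, rfl⟩) (Set.inv_mem_inv.2 ⟨x, y, rfl⟩))
  obtain ⟨F, hF, hsub⟩ := hΞ.2.2
  exact ⟨⟨hsymm, hone, _, (key F hF hsub).2, (key F hF hsub).1⟩, hsymm, hone, key⟩
end

section
/- If (X, d_X) and (Y, d_Y) are coarsely equivalent metric spaces, then asdim X = asdim Y; that is, asymptotic dimension is a coarse invariant. -/
open Set Filter Pointwise

theorem asdimLE_pullback {X Y : Type*} (dX : X → X → ℝ) (dY : Y → Y → ℝ) (f : X → Y)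
    (hA : ∀ r : ℝ, ∃ S : ℝ, ∀ x x', dX x x' ≤ r → dY (f x) (f x') ≤ S)
    (hB : ∀ r : ℝ, ∃ S : ℝ, ∀ x x', dY (f x) (f x') ≤ r → dX x x' ≤ S)
    (n : ℕ) (h : ASDimLE dY univ n) : ASDimLE dX univ n := by
  intro R hR
  obtain ⟨S, hS⟩ := hA R
  obtain ⟨D, hD, U, -, hcov, hbd, hdis⟩ := h (max S 0 + 1) (by positivity)
  obtain ⟨T, hT⟩ := hB D
  refine ⟨max T 0 + 1, by positivity, fun i => (fun u => f ⁻¹' u) '' U i,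
    fun _ _ _ => subset_univ _, ?_, ?_, ?_⟩
  · intro x _
    have hx := hcov (mem_univ (f x))
    simp only [mem_iUnion, mem_sUnion] at hx ⊢
    obtain ⟨i, u, hu, hxu⟩ := hx
    exact ⟨i, f ⁻¹' u, ⟨u, hu, rfl⟩, hxu⟩
  · rintro i _ ⟨u, hu, rfl⟩ x hx y hy
    have h1 := hT x y (hbd i u hu _ hx _ hy)
    have h2 := le_max_left T 0
    linarith
  · rintro i _ ⟨u, hu, rfl⟩ _ ⟨v, hv, rfl⟩ huv x hx y hy
    have hne : u ≠ v := fun e => huv (by rw [e])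
    have h1 := hdis i u hu v hv hne _ hx _ hy
    by_contra hlt
    have h2 := hS x y (not_le.mp hlt).le
    have h3 := le_max_left S 0
    linarith

/-- asymptotic dimension is a coarse invariant: coarsely equivalent metric
spaces have equal asymptotic dimension. -/
theorem asdim_eq_of_coarseEquiv
    {X Y : Type*} (dX : X → X → ℝ) (dY : Y → Y → ℝ)
    (hX : IsMetric dX) (hY : IsMetric dY)
    (h : ∃ f : X → Y, IsCoarseEquiv dX dY f) :
    asdim dX (univ : Set X) = asdim dY (univ : Set Y) := by
  obtain ⟨f, -, ⟨Φm, Φp, -, -, -, hp, hmt, -, hΦ⟩, L, hL, hd⟩ := h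
  have hA : ∀ r : ℝ, ∃ S : ℝ, ∀ x x', dX x x' ≤ r → dY (f x) (f x') ≤ S := by
    intro r
    refine ⟨Φp (max r 0), fun x x' hr => ?_⟩
    exact ((hΦ x (mem_univ _) x' (mem_univ _)).2).trans
      (hp (hX.1 x x') (le_max_right r 0) (hr.trans (le_max_left r 0)))
  have hB : ∀ r : ℝ, ∃ S : ℝ, ∀ x x', dY (f x) (f x') ≤ r → dX x x' ≤ S := by
    intro r
    obtain ⟨t, ht⟩ := eventually_atTop.mp (hmt.eventually_gt_atTop r)
    refine ⟨t, fun x x' hr => ?_⟩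
    by_contra hlt
    have h1 := ht _ (not_le.mp hlt).le
    have h2 := (hΦ x (mem_univ _) x' (mem_univ _)).1
    linarith
  choose g _ hg using fun y => hd y (mem_univ y)
  have hsym := hY.2.2.1
  have htri := hY.2.2.2
  have hA' : ∀ r : ℝ, ∃ S : ℝ, ∀ y y', dY y y' ≤ r → dX (g y) (g y') ≤ S := by
    intro r
    obtain ⟨S, hS⟩ := hB (r + 2 * L)
    refine ⟨S, fun y y' hr => hS _ _ ?_⟩
    have h1 := htri (f (g y)) y (f (g y'))
    have h2 := htri y y' (f (g y'))
    have h3 := hsym (f (g y)) y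
    linarith [hg y, hg y']
  have hB' : ∀ r : ℝ, ∃ S : ℝ, ∀ y y', dX (g y) (g y') ≤ r → dY y y' ≤ S := by
    intro r
    obtain ⟨S, hS⟩ := hA r
    refine ⟨S + 2 * L, fun y y' hr => ?_⟩
    have h0 := hS _ _ hr
    have h1 := htri y (f (g y)) y'
    have h2 := htri (f (g y)) (f (g y')) y'
    have h3 := hsym (f (g y')) y'
    linarith [hg y, hg y']
  have key : {n | ASDimLE dX univ n} = {n | ASDimLE dY univ n} := by
    ext n
    exact ⟨asdimLE_pullback dY dX g hA' hB' n, asdimLE_pullback dX dY f hA hB n⟩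
  unfold asdim
  rw [key]
end
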